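/- Let λ ≥ 2 and μ ≥ 1 be cardinals and α ≥ 1 an ordinal. The tree ⋃·_μ ^{<α}λ, the disjoint union of μ-many copies of the complete λ-ary tree of height α, is reversible if and only if min{α, λ·μ} < ω (that is, iff α is finite, or both λ and μ are finite). -/

import Mathlib

/- A tree is a partial order in which the set of strict predecessors of every
element is well-ordered. Basic vocabulary: condensations, automorphisms,
reversibility, heights, levels, nodes, upward closures, branches. -/

universe u v

/- The height of an element `t`: the order type of the set `(·,t)` of its strict
predecessors (which is well-ordered when the order is a tree). -/
open Classical in
noncomputable def treeHt {T : Type u} [PartialOrder T] (t : T) : Ordinal.{u} :=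
  if h : IsWellOrder {s : T // s < t} (fun a b => (a : T) < (b : T)) then
    @Ordinal.type {s : T // s < t} (fun a b => (a : T) < (b : T)) h
  else 0

/-- A partial order is a tree iff every set `(·,t)` is well-ordered by `<`. -/
def IsTree (T : Type u) [PartialOrder T] : Prop :=
  ∀ t : T, IsWellOrder {s : T // s < t} (fun a b => (a : T) < (b : T))

/-- A condensation: a bijective endomorphism. -/
def IsCond {T : Type u} [PartialOrder T] (f : T → T) : Prop :=
  Function.Bijective f ∧ ∀ s t : T, s < t → f s < f t

/-- An automorphism: a bijection preserving and reflecting `<`. -/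
def IsAuto {T : Type u} [PartialOrder T] (f : T → T) : Prop :=
  Function.Bijective f ∧ ∀ s t : T, s < t ↔ f s < f t

/-- A structure is reversible iff every condensation is an automorphism. -/
def Reversible (T : Type u) [PartialOrder T] : Prop :=
  ∀ f : T → T, IsCond f → IsAuto f

/-- The `α`-th level: elements of height `α`. -/
def level (T : Type u) [PartialOrder T] (α : Ordinal.{u}) : Set T :=
  {t : T | treeHt t = α}

/-- The height of the tree: the least ordinal `α` with `L_α = ∅`. -/
noncomputable def treeHeight (T : Type u) [PartialOrder T] : Ordinal.{u} :=
  sInf {α : Ordinal.{u} | level T α = ∅}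

/-- Nodes: equivalence classes of the relation `s ∼ t` iff `(·,s) = (·,t)`. -/
def IsNode {T : Type u} [PartialOrder T] (N : Set T) : Prop :=
  ∃ t : T, N = {s : T | Set.Iio s = Set.Iio t}

/-- `S↑`, the upward closure of `S`. -/
def upClo {T : Type u} [PartialOrder T] (S : Set T) : Set T :=
  {t : T | ∃ s ∈ S, s ≤ t}

/-- A branch: a maximal chain. -/
def IsBranch {T : Type u} [PartialOrder T] (b : Set T) : Prop :=
  IsMaxChain (· ≤ ·) b

/- The height (order type) of a chain (junk value `0` if not well-ordered;
in a tree every chain is well-ordered). -/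
open Classical in
noncomputable def chainHt {T : Type u} [PartialOrder T] (b : Set T) : Ordinal.{u} :=
  if h : IsWellOrder b (fun x y : b => (x : T) < (y : T)) then
    @Ordinal.type b (fun x y : b => (x : T) < (y : T)) h
  else 0

/-- The complete `λ`-ary tree `^{<α}λ` of height `α` over a type `L` (of
cardinality `λ`): all functions `φ : β → L` for ordinals `β < α`, represented by
their graphs (subsets of `Ordinal × L` that are functions whose domain is an
ordinal `β < α`), ordered by strict end-extension, i.e. by strict inclusion of
graphs. -/
def CompleteTree (α : Ordinal.{u}) (L : Type u) : Type (u + 1) :=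
  {s : Set (Ordinal.{u} × L) //
    ∃ β < α, (∀ p ∈ s, p.1 < β) ∧ ∀ γ < β, ∃! x : L, (γ, x) ∈ s}

instance (α : Ordinal.{u}) (L : Type u) : PartialOrder (CompleteTree α L) :=
  inferInstanceAs (PartialOrder {s : Set (Ordinal.{u} × L) //
    ∃ β < α, (∀ p ∈ s, p.1 < β) ∧ ∀ γ < β, ∃! x : L, (γ, x) ∈ s})

namespace CompleteTree

variable {α : Ordinal.{u}} {L : Type u}

theorem le_iff_subset {s t : CompleteTree α L} : s ≤ t ↔ s.1 ⊆ t.1 := Iff.rfl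

/-- The domain of a sequence. -/
noncomputable def len (s : CompleteTree α L) : Ordinal.{u} := s.2.choose

theorem len_lt (s : CompleteTree α L) : s.len < α := s.2.choose_spec.1

/-- The value of a sequence at `γ` (arbitrary outside of the domain). -/
noncomputable def coord [Nonempty L] (s : CompleteTree α L) (γ : Ordinal.{u}) : L :=
  Classical.epsilon fun x => (γ, x) ∈ s.1

theorem mem_iff [Nonempty L] (s : CompleteTree α L) (γ : Ordinal.{u}) (x : L) :
    (γ, x) ∈ s.1 ↔ γ < s.len ∧ s.coord γ = x := by
  obtain ⟨-, h₁, h₂⟩ := s.2.choose_spec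
  have key : ∀ δ < s.len, (δ, s.coord δ) ∈ s.1 := fun δ hδ =>
    Classical.epsilon_spec (p := fun x => (δ, x) ∈ s.1) (h₂ δ hδ).exists
  constructor
  · intro h
    have hγ : γ < s.len := h₁ _ h
    exact ⟨hγ, (h₂ γ hγ).unique (key γ hγ) h⟩
  · rintro ⟨hγ, rfl⟩
    exact key γ hγ

theorem le_iff [Nonempty L] {s t : CompleteTree α L} :
    s ≤ t ↔ s.len ≤ t.len ∧ ∀ γ < s.len, s.coord γ = t.coord γ := by
  rw [le_iff_subset]
  constructor
  · intro h
    have key : ∀ γ < s.len, γ < t.len ∧ t.coord γ = s.coord γ := fun γ hγ =>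
      (t.mem_iff _ _).1 (h ((s.mem_iff _ _).2 ⟨hγ, rfl⟩))
    exact ⟨le_of_forall_lt fun γ hγ => (key γ hγ).1, fun γ hγ => (key γ hγ).2.symm⟩
  · rintro ⟨h₁, h₂⟩ ⟨γ, x⟩ h
    obtain ⟨hγ, rfl⟩ := (s.mem_iff _ _).1 h
    exact (t.mem_iff _ _).2 ⟨hγ.trans_le h₁, (h₂ γ hγ).symm⟩

theorem ext_coord [Nonempty L] {s t : CompleteTree α L} (h : s.len = t.len)
    (h' : ∀ γ < s.len, s.coord γ = t.coord γ) : s = t :=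
  le_antisymm (le_iff.2 ⟨h.le, h'⟩) (le_iff.2 ⟨h.ge, fun γ hγ => (h' γ (h ▸ hγ)).symm⟩)

theorem lt_iff [Nonempty L] {s t : CompleteTree α L} :
    s < t ↔ s.len < t.len ∧ ∀ γ < s.len, s.coord γ = t.coord γ := by
  constructor
  · intro h
    obtain ⟨h₁, h₂⟩ := le_iff.1 h.le
    exact ⟨h₁.lt_of_ne fun e => h.ne (ext_coord e h₂), h₂⟩
  · rintro ⟨h₁, h₂⟩
    refine (le_iff.2 ⟨h₁.le, h₂⟩).lt_of_ne ?_
    rintro rfl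
    exact h₁.false

/-- The sequence with domain `β` and values given by `φ`. -/
def ofFun (β : Ordinal.{u}) (hβ : β < α) (φ : Ordinal.{u} → L) : CompleteTree α L :=
  ⟨{p | p.1 < β ∧ φ p.1 = p.2}, β, hβ, fun _ hp => hp.1, fun γ hγ =>
    ⟨φ γ, ⟨hγ, rfl⟩, fun _ hy => hy.2.symm⟩⟩

theorem mem_ofFun {β : Ordinal.{u}} (hβ : β < α) (φ : Ordinal.{u} → L) (γ : Ordinal.{u}) (x : L) :
    (γ, x) ∈ (ofFun β hβ φ).1 ↔ γ < β ∧ φ γ = x := Iff.rfl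

@[simp]
theorem len_ofFun [Nonempty L] {β : Ordinal.{u}} (hβ : β < α) (φ : Ordinal.{u} → L) :
    (ofFun β hβ φ).len = β := by
  refine eq_of_forall_lt_iff fun γ => ?_
  constructor
  · intro h
    exact ((mem_ofFun hβ φ _ _).1 ((mem_iff _ γ _).2 ⟨h, rfl⟩)).1
  · intro h
    exact ((mem_iff _ γ _).1 ((mem_ofFun hβ φ _ _).2 ⟨h, rfl⟩)).1

theorem coord_ofFun [Nonempty L] {β : Ordinal.{u}} (hβ : β < α) (φ : Ordinal.{u} → L)
    {γ : Ordinal.{u}} (h : γ < β) : (ofFun β hβ φ).coord γ = φ γ :=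
  ((mem_iff _ γ _).1 ((mem_ofFun hβ φ _ _).2 ⟨h, rfl⟩)).2

end CompleteTree

section Reversibility

theorem Reversible.of_orderIso {X : Type*} {Y : Type*} [PartialOrder X] [PartialOrder Y]
    (e : X ≃o Y) (h : Reversible X) : Reversible Y := by
  intro f hf
  have hc : IsCond (fun x => e.symm (f (e x))) :=
    ⟨e.symm.bijective.comp (hf.1.comp e.bijective), fun s t hst => by
      simpa using hf.2 _ _ (e.lt_iff_lt.2 hst)⟩
  refine ⟨hf.1, fun s t => ?_⟩
  simpa using (h _ hc).2 (e.symm s) (e.symm t)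

theorem Reversible.of_withBot {X : Type*} [PartialOrder X] (h : Reversible (WithBot X)) :
    Reversible X := by
  intro f hf
  have hc : IsCond (WithBot.map f) := by
    refine ⟨⟨WithBot.map_injective hf.1.1, ?_⟩, ?_⟩
    · intro y
      induction y with
      | bot => exact ⟨⊥, rfl⟩
      | coe y =>
        obtain ⟨x, rfl⟩ := hf.1.2 y
        exact ⟨x, rfl⟩
    · intro s t hst
      induction t with
      | bot => simp at hst
      | coe t =>
        induction s with
        | bot => simp
        | coe s => simpa using hf.2 s t (by simpa using hst)
  exact ⟨hf.1, fun s t => by simpa using (h _ hc).2 s t⟩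

theorem Reversible.of_sigma {M : Type*} {S : Type*} [PartialOrder S] [Nonempty M]
    (h : Reversible (Σ _ : M, S)) : Reversible S := by
  intro f hf
  obtain ⟨m⟩ := ‹Nonempty M›
  have hc : IsCond (fun p : (Σ _ : M, S) => (⟨p.1, f p.2⟩ : Σ _ : M, S)) := by
    refine ⟨⟨?_, ?_⟩, ?_⟩
    · rintro ⟨m, s⟩ ⟨m', s'⟩ h
      obtain ⟨h₁, h₂⟩ := Sigma.mk.inj_iff.1 h
      dsimp only at h₁ h₂
      subst h₁
      rw [hf.1.1 (eq_of_heq h₂)]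
    · rintro ⟨m, s⟩
      obtain ⟨x, rfl⟩ := hf.1.2 s
      exact ⟨⟨m, x⟩, rfl⟩
    · rintro _ _ ⟨i, s, t, hst⟩
      exact Sigma.LT.fiber _ _ _ (hf.2 _ _ hst)
  refine ⟨hf.1, fun s t => ?_⟩
  simpa using (h _ hc).2 ⟨m, s⟩ ⟨m, t⟩

end Reversibility

section SelfSimilar

variable {L : Type*} {S : Type*} [PartialOrder S]

/-- The cone `S` over the first letter `x`. -/
def SelfSimilar.cons (i : WithBot (Σ _ : L, S) ≃o S) (x : L) (s : S) : S :=
  i ((⟨x, s⟩ : Σ _ : L, S) : WithBot (Σ _ : L, S))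

namespace SelfSimilar

variable {i : WithBot (Σ _ : L, S) ≃o S}

theorem cons_lt_cons {x y : L} {s t : S} : cons i x s < cons i y t ↔ x = y ∧ s < t := by
  simp only [cons, OrderIso.lt_iff_lt, WithBot.coe_lt_coe]
  constructor
  · rintro ⟨_, _, _, h⟩
    exact ⟨rfl, h⟩
  · rintro ⟨rfl, h⟩
    exact Sigma.LT.fiber _ _ _ h

theorem cons_inj {x y : L} {s t : S} : cons i x s = cons i y t ↔ x = y ∧ s = t := by
  simp [cons]

theorem bot_lt_cons (x : L) (s : S) : i ⊥ < cons i x s := by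
  simp [cons]

theorem eq_bot_or_cons (i : WithBot (Σ _ : L, S) ≃o S) (s : S) :
    s = i ⊥ ∨ ∃ x u, s = cons i x u := by
  obtain ⟨p, rfl⟩ := i.surjective s
  induction p with
  | bot => exact Or.inl rfl
  | coe p => exact Or.inr ⟨p.1, p.2, rfl⟩

/-- Elements beginning with `aⁿb` for some `n`. -/
inductive Shifted (i : WithBot (Σ _ : L, S) ≃o S) (a b : L) : S → Prop
  | base (u : S) : Shifted i a b (cons i b u)
  | step (u : S) : Shifted i a b u → Shifted i a b (cons i a u)

variable {a b : L}

theorem eq_cons_of_cons_lt {x : L} {u t : S} (h : cons i x u < t) : ∃ v, t = cons i x v ∧ u < v := by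
  obtain rfl | ⟨y, v, rfl⟩ := eq_bot_or_cons i t
  · exact absurd (bot_lt_cons x u) h.asymm
  · obtain ⟨rfl, huv⟩ := cons_lt_cons.1 h
    exact ⟨v, rfl, huv⟩

theorem Shifted.mono {s : S} (hs : Shifted i a b s) : ∀ {t : S}, s < t → Shifted i a b t := by
  induction hs with
  | base u =>
    intro t h
    obtain ⟨v, rfl, -⟩ := eq_cons_of_cons_lt h
    exact .base v
  | step u _ ih =>
    intro t h
    obtain ⟨v, rfl, hv⟩ := eq_cons_of_cons_lt h
    exact .step v (ih hv)

theorem Shifted.lt_cons {t : S} (ht : Shifted i a b t) :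
    ∀ {s : S}, ¬ Shifted i a b s → s < t → s < cons i a t := by
  induction ht with
  | base u =>
    intro s hs h
    obtain rfl | ⟨x, v, rfl⟩ := eq_bot_or_cons i s
    · exact bot_lt_cons _ _
    · obtain ⟨rfl, -⟩ := cons_lt_cons.1 h
      exact absurd (.base v) hs
  | step u _ ih =>
    intro s hs h
    obtain rfl | ⟨x, v, rfl⟩ := eq_bot_or_cons i s
    · exact bot_lt_cons _ _
    · obtain ⟨rfl, hv⟩ := cons_lt_cons.1 h
      exact cons_lt_cons.2 ⟨rfl, ih (fun h' => hs (.step v h')) hv⟩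

open Classical in
/-- A map which condenses two copies of `S` onto one: the second copy becomes the cone over `b`,
and the cones over `aⁿb` in the first copy are moved to the cones over `aⁿ⁺¹b`. -/
noncomputable def merge (i : WithBot (Σ _ : L, S) ≃o S) (a b : L) : Bool → S → S
  | true, s => cons i b s
  | false, s => if Shifted i a b s then cons i a s else s

theorem merge_strictMono (c : Bool) {s t : S} (h : s < t) :
    merge i a b c s < merge i a b c t := by
  cases c with
  | true => exact cons_lt_cons.2 ⟨rfl, h⟩
  | false =>
    by_cases hs : Shifted i a b s
    · simpa [merge, hs, hs.mono h] using cons_lt_cons.2 ⟨rfl, h⟩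
    · by_cases ht : Shifted i a b t
      · simpa [merge, hs, ht] using ht.lt_cons hs h
      · simpa [merge, hs, ht] using h

theorem merge_injective (hab : a ≠ b) {c d : Bool} {s t : S}
    (h : merge i a b c s = merge i a b d t) : c = d ∧ s = t := by
  have key : ∀ {s t : S}, merge i a b true s ≠ merge i a b false t := by
    intro s t h
    by_cases ht : Shifted i a b t
    · simp only [merge, ht, if_true, cons_inj] at h
      exact hab h.1.symm
    · simp only [merge, ht, if_false] at h
      exact ht (h ▸ .base s)
  cases c <;> cases d
  · refine ⟨rfl, ?_⟩
    by_cases hs : Shifted i a b s <;> by_cases ht : Shifted i a b t <;>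
      simp only [merge, hs, ht, if_true, if_false] at h
    · exact (cons_inj.1 h).2
    · exact absurd (h ▸ .step s hs) ht
    · exact absurd (h ▸ .step t ht) hs
    · exact h
  · exact absurd h.symm key
  · exact absurd h key
  · exact ⟨rfl, (cons_inj.1 h).2⟩

theorem merge_surjective (t : S) : ∃ c s, merge i a b c s = t := by
  by_cases ht : Shifted i a b t
  · cases ht with
    | base u => exact ⟨true, u, rfl⟩
    | step u hu => exact ⟨false, u, by simp [merge, hu]⟩
  · exact ⟨false, t, by simp [merge, ht]⟩

theorem merge_bot : merge i a b false (i ⊥) = i ⊥ := by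
  have : ¬ Shifted i a b (i ⊥) := by
    intro h
    generalize hs : i ⊥ = s at h
    cases h with
    | base u => exact (bot_lt_cons b u).ne hs
    | step u _ => exact (bot_lt_cons a u).ne hs
  simp [merge, this]

theorem not_reversible_sigma (i : WithBot (Σ _ : L, S) ≃o S) [Nontrivial L] (M : Type*)
    [Infinite M] : ¬ Reversible (Σ _ : M, S) := by
  intro hrev
  obtain ⟨a, b, hab⟩ := exists_pair_ne L
  have hcard : Cardinal.mk (M × Bool) = Cardinal.mk M := by
    have := Cardinal.mul_eq_left (Cardinal.aleph0_le_mk M)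
      ((Cardinal.natCast_lt_aleph0 (n := 2)).le.trans (Cardinal.aleph0_le_mk M)) (by simp)
    simpa using this
  obtain ⟨e⟩ := Cardinal.eq.1 hcard.symm
  let f : (Σ _ : M, S) → (Σ _ : M, S) := fun p =>
    ⟨(e p.1).1, merge i a b (e p.1).2 p.2⟩
  have hf : IsCond f := by
    refine ⟨⟨?_, ?_⟩, ?_⟩
    · rintro ⟨m, s⟩ ⟨m', s'⟩ h
      obtain ⟨h₁, h₂⟩ := Sigma.mk.inj_iff.1 h
      obtain ⟨h₃, h₄⟩ := merge_injective hab (eq_of_heq h₂)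
      dsimp only at h₁ h₃ h₄
      rw [h₄, e.injective (Prod.ext h₁ h₃)]
    · rintro ⟨m, t⟩
      obtain ⟨c, s, rfl⟩ := merge_surjective (i := i) (a := a) (b := b) t
      exact ⟨⟨e.symm (m, c), s⟩, by simp [f]⟩
    · rintro _ _ ⟨m, s, t, hst⟩
      exact Sigma.LT.fiber _ _ _ (merge_strictMono _ hst)
  obtain ⟨m⟩ : Nonempty M := inferInstance
  have h : f ⟨e.symm (m, false), i ⊥⟩ < f ⟨e.symm (m, true), i ⊥⟩ := by
    simp only [f, Equiv.apply_symm_apply, merge_bot]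
    exact Sigma.LT.fiber _ _ _ (bot_lt_cons _ _)
  obtain ⟨h', -⟩ := Sigma.lt_def.1 (((hrev f hf).2 _ _).2 h)
  simp at h'

theorem infinite_imp_not_reversible (i : WithBot (Σ _ : L, S) ≃o S) [Nontrivial L] {M : Type*}
    [Nonempty M] (h : Infinite L ∨ Infinite M) : ¬ Reversible (Σ _ : M, S) := by
  intro hrev
  rcases h with h | h
  · exact not_reversible_sigma i L (hrev.of_sigma.of_orderIso i.symm).of_withBot
  · exact not_reversible_sigma i M hrev

end SelfSimilar

end SelfSimilar

/-- A forest with a rank function whose values on the principal ideals are initial segments. -/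
structure IsRank {T : Type*} [PartialOrder T] (ht : T → Ordinal.{u}) : Prop where
  strictMono : ∀ {s t : T}, s < t → ht s < ht t
  exists_le : ∀ (t : T), ∀ γ ≤ ht t, ∃ s ≤ t, ht s = γ
  unique : ∀ {s s' t : T}, s ≤ t → s' ≤ t → ht s = ht s' → s = s'

namespace IsRank

variable {T : Type*} [PartialOrder T] {ht : T → Ordinal.{u}} {f : T → T}

theorem exists_lt (h : IsRank ht) (t : T) {γ : Ordinal.{u}} (hγ : γ < ht t) :
    ∃ s < t, ht s = γ := by
  obtain ⟨s, hs, rfl⟩ := h.exists_le t γ hγ.le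
  exact ⟨s, hs.lt_of_ne (by rintro rfl; exact hγ.false), rfl⟩

theorem le_apply (h : IsRank ht) (hf : IsCond f) (t : T) : ht t ≤ ht (f t) := by
  induction hγ : ht t using WellFoundedLT.induction generalizing t with
  | ind γ ih =>
    refine le_of_forall_lt fun δ hδ => ?_
    obtain ⟨s, hs, hs'⟩ := h.exists_lt t (hγ ▸ hδ)
    exact (ih δ hδ s hs').trans_lt (h.strictMono (hf.2 _ _ hs))

theorem isAuto_of_apply_eq (h : IsRank ht) (hf : IsCond f) (he : ∀ t, ht (f t) = ht t) :
    IsAuto f := by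
  refine ⟨hf.1, fun s t => ⟨hf.2 s t, fun hst => ?_⟩⟩
  have hlt := h.strictMono hst
  rw [he, he] at hlt
  obtain ⟨r, hr, hrs⟩ := h.exists_lt t hlt
  have : f r = f s := h.unique (hf.2 _ _ hr).le hst.le (by rw [he, he, hrs])
  rwa [← hf.1.1 this]

theorem reversible_of_finite_height (h : IsRank ht) {α : Ordinal.{u}} (hα : α < Ordinal.omega0)
    (hlt : ∀ t, ht t < α) (hext : ∀ t, ht t + 1 < α → ∃ t' > t, ht t' = ht t + 1) :
    Reversible T := by
  intro f hf
  refine h.isAuto_of_apply_eq hf ?_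
  obtain ⟨n, rfl⟩ := Ordinal.lt_omega0.1 hα
  have key : ∀ j k : ℕ, k + j + 1 = n → ∀ t, ht t = k → ht (f t) = k := by
    intro j
    induction j with
    | zero =>
      rintro k rfl t ht'
      refine le_antisymm ?_ (ht' ▸ h.le_apply hf t)
      simpa using hlt (f t)
    | succ j ih =>
      rintro k hk t ht'
      refine le_antisymm ?_ (ht' ▸ h.le_apply hf t)
      obtain ⟨t', htt', hrank⟩ := hext t (by rw [ht']; exact_mod_cast (by omega : k + 1 < n))
      have hrank' : ht t' = ((k + 1 : ℕ) : Ordinal.{u}) := by rw [hrank, ht']; simp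
      have := h.strictMono (hf.2 _ _ htt')
      rw [ih (k + 1) (by omega) t' hrank'] at this
      simpa using this
  intro t
  obtain ⟨k, hk⟩ := Ordinal.lt_omega0.1 ((hlt t).trans hα)
  have hkn : k < n := by exact_mod_cast hk ▸ hlt t
  rw [hk]
  exact key (n - k - 1) k (by omega) t hk

/-- The elements having the same rank and the same predecessors as `t`. -/
def node (ht : T → Ordinal.{u}) (t : T) : Set T :=
  {s | ht s = ht t ∧ ∀ r < s, r < t}

theorem reversible_of_finite_node (h : IsRank ht) (hfin : ∀ t, (node ht t).Finite)
    (hhom : ∀ t t', ht t = ht t' → (node ht t).ncard ≤ (node ht t').ncard) : Reversible T := by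
  intro f hf
  refine h.isAuto_of_apply_eq hf fun t => ?_
  induction hγ : ht t using WellFoundedLT.induction generalizing t with
  | ind γ ih =>
    obtain ⟨t', ht', hrank⟩ := h.exists_le (f t) γ (hγ ▸ h.le_apply hf t)
    have hsub : f ⁻¹' node ht t' ⊆ node ht t := by
      rintro s ⟨hs, hs'⟩
      have hsγ : ht s = γ := by
        have hle := h.le_apply hf s
        rw [hs, hrank] at hle
        refine hle.eq_of_not_lt fun hlt => ?_
        have := ih _ hlt s rfl
        rw [hs, hrank] at this
        exact hlt.ne this.symm
      refine ⟨hsγ.trans hγ.symm, fun r hr => ?_⟩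
      have hrγ : ht r < γ := hsγ ▸ h.strictMono hr
      obtain ⟨r', hr', hrr'⟩ := h.exists_lt t (hγ ▸ hrγ)
      have : f r = f r' := h.unique ((hs' _ (hf.2 _ _ hr)).le.trans ht') (hf.2 _ _ hr').le (by
        rw [ih _ hrγ r rfl, ih _ hrγ r' hrr'])
      rwa [hf.1.1 this]
    have hcard : (f ⁻¹' node ht t').ncard = (node ht t').ncard :=
      Set.ncard_preimage_of_injective_subset_range hf.1.1 (by simp [hf.1.2.range_eq])
    have heq := Set.eq_of_subset_of_ncard_le hsub
      (hcard ▸ hhom t t' (hγ.trans hrank.symm)) (hfin t)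
    have hmem : t ∈ f ⁻¹' node ht t' := heq ▸ ⟨rfl, fun _ hr => hr⟩
    exact hmem.1.trans hrank

theorem ncard_node_le_of_orderIso (σ : T ≃o T) (hσ : ∀ t, ht (σ t) = ht t)
    (t : T) (hfin : (node ht (σ t)).Finite) : (node ht t).ncard ≤ (node ht (σ t)).ncard := by
  refine Set.ncard_le_ncard_of_injOn σ ?_ σ.injective.injOn hfin
  rintro s ⟨hs, hs'⟩
  refine ⟨by rw [hσ, hσ, hs], fun r hr => ?_⟩
  have := hs' (σ.symm r) (by rwa [OrderIso.symm_apply_lt])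
  rwa [OrderIso.symm_apply_lt] at this

end IsRank

namespace CompleteTree

variable {α : Ordinal.{u}} {L : Type u} {M : Type u} [Nonempty L]

/-- Prefixing a sequence with a letter. -/
noncomputable def prepend (hα : Ordinal.omega0 ≤ α) (x : L) (s : CompleteTree α L) :
    CompleteTree α L :=
  ofFun (1 + s.len)
    (by
      rcases lt_or_ge s.len Ordinal.omega0 with h | h
      · exact (Ordinal.isPrincipal_add_omega0 Ordinal.one_lt_omega0 h).trans_le hα
      · rw [Ordinal.one_add_of_omega0_le h]
        exact s.len_lt)
    fun γ => if γ = 0 then x else s.coord (γ - 1)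

section prepend

variable (hα : Ordinal.omega0 ≤ α)

theorem len_prepend (x : L) (s : CompleteTree α L) : (prepend hα x s).len = 1 + s.len :=
  len_ofFun _ _

theorem coord_prepend_zero (x : L) (s : CompleteTree α L) : (prepend hα x s).coord 0 = x := by
  rw [prepend, coord_ofFun _ _ (zero_lt_one.trans_le le_self_add)]
  simp

theorem coord_prepend_one_add (x : L) (s : CompleteTree α L) {γ : Ordinal.{u}} (h : γ < s.len) :
    (prepend hα x s).coord (1 + γ) = s.coord γ := by
  rw [prepend, coord_ofFun _ _ (by simpa using h)]
  simp

theorem prepend_le_prepend {x y : L} {s t : CompleteTree α L} :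
    prepend hα x s ≤ prepend hα y t ↔ x = y ∧ s ≤ t := by
  simp only [le_iff, len_prepend, add_le_add_iff_left]
  constructor
  · rintro ⟨h₁, h₂⟩
    refine ⟨?_, h₁, fun γ hγ => ?_⟩
    · simpa only [coord_prepend_zero] using h₂ 0 (zero_lt_one.trans_le le_self_add)
    · have := h₂ (1 + γ) (by simpa using hγ)
      rwa [coord_prepend_one_add hα x s hγ, coord_prepend_one_add hα y t (hγ.trans_le h₁)] at this
  · rintro ⟨rfl, h₁, h₂⟩
    refine ⟨h₁, fun γ hγ => ?_⟩
    rcases eq_or_ne γ 0 with rfl | h0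
    · rw [coord_prepend_zero, coord_prepend_zero]
    · obtain ⟨δ, rfl⟩ := exists_add_of_le (Order.one_le_iff_pos.2 (pos_iff_ne_zero.2 h0))
      have hδ : δ < s.len := by simpa using hγ
      rw [coord_prepend_one_add hα x s hδ, coord_prepend_one_add hα x t (hδ.trans_le h₁),
        h₂ δ hδ]

theorem eq_prepend (s : CompleteTree α L) (h : s.len ≠ 0) : ∃ x u, prepend hα x u = s := by
  obtain ⟨δ, hδ⟩ := exists_add_of_le (Order.one_le_iff_pos.2 (pos_iff_ne_zero.2 h))
  have hδα : δ < α := lt_of_le_of_lt (by rw [hδ]; exact le_add_self) s.len_lt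
  refine ⟨s.coord 0, ofFun δ hδα fun γ => s.coord (1 + γ), ext_coord ?_ fun γ hγ => ?_⟩
  · rw [len_prepend, len_ofFun, hδ]
  · rw [len_prepend, len_ofFun] at hγ
    rcases eq_or_ne γ 0 with rfl | h0
    · rw [coord_prepend_zero]
    · obtain ⟨ε, rfl⟩ := exists_add_of_le (Order.one_le_iff_pos.2 (pos_iff_ne_zero.2 h0))
      have hε : ε < δ := by simpa using hγ
      rw [coord_prepend_one_add hα _ _ (by rwa [len_ofFun]), coord_ofFun _ _ hε]

/-- A complete tree of infinite height is a root below `L`-many copies of itself. -/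
noncomputable def selfSimilar : WithBot (Σ _ : L, CompleteTree α L) ≃o CompleteTree α L :=
  let root : CompleteTree α L :=
    ofFun 0 (Ordinal.omega0_pos.trans_le hα) fun _ => Classical.arbitrary L
  RelIso.ofSurjective
    (OrderEmbedding.ofMapLEIff
      (fun p : WithBot (Σ _ : L, CompleteTree α L) =>
        p.recBotCoe root (fun q => prepend hα q.1 q.2))
      (by
        intro p q
        induction p with
        | bot => simp [le_iff, root]
        | coe p =>
          induction q with
          | bot => simp [le_iff, root, len_prepend]
          | coe q =>
            obtain ⟨x, s⟩ := p
            obtain ⟨y, t⟩ := q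
            simp only [WithBot.recBotCoe_coe, prepend_le_prepend, WithBot.coe_le_coe]
            constructor
            · rintro ⟨rfl, h⟩
              exact Sigma.LE.fiber _ _ _ h
            · rintro ⟨_, _, _, h⟩
              exact ⟨rfl, h⟩))
    (by
      intro s
      by_cases h : s.len = 0
      · exact ⟨⊥, ext_coord (by simp [root, h]) (by simp [root])⟩
      · obtain ⟨x, u, rfl⟩ := eq_prepend hα s h
        exact ⟨((⟨x, u⟩ : Σ _ : L, CompleteTree α L) : WithBot _), rfl⟩)

end prepend

theorem isRank_len : IsRank (fun p : (Σ _ : M, CompleteTree α L) => p.2.len) where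
  strictMono := by
    rintro _ _ ⟨m, s, t, h⟩
    exact (lt_iff.1 h).1
  exists_le := by
    rintro ⟨m, t⟩ γ hγ
    have hα : γ < α := lt_of_le_of_lt hγ t.len_lt
    refine ⟨⟨m, ofFun γ hα t.coord⟩, Sigma.LE.fiber _ _ _ ?_,
      len_ofFun hα _⟩
    exact le_iff.2 ⟨by simpa using hγ, fun δ hδ => coord_ofFun _ _ (by simpa using hδ)⟩
  unique := by
    rintro _ _ _ ⟨m, s, t, h⟩ ⟨_, s', _, h'⟩ he
    dsimp only at he
    rw [le_iff] at h h'
    rw [ext_coord he fun γ hγ => (h.2 γ hγ).trans (h'.2 γ (he ▸ hγ)).symm]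

theorem exists_succ (p : Σ _ : M, CompleteTree α L) (h : p.2.len + 1 < α) :
    ∃ q > p, q.2.len = p.2.len + 1 := by
  obtain ⟨m, s⟩ := p
  refine ⟨⟨m, ofFun (s.len + 1) h s.coord⟩, Sigma.LT.fiber _ _ _ (lt_iff.2 ⟨?_, fun γ hγ => ?_⟩),
    len_ofFun h _⟩
  · rw [len_ofFun]
    exact lt_add_one _
  · rw [coord_ofFun]
    exact hγ.trans (lt_add_one _)

open Classical in
/-- The map exchanging, in each coordinate, the values of `s` and `t`. -/
noncomputable def swapMap (s t r : CompleteTree α L) : CompleteTree α L :=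
  ofFun r.len r.len_lt fun γ => Equiv.swap (s.coord γ) (t.coord γ) (r.coord γ)

theorem len_swapMap (s t r : CompleteTree α L) : (swapMap s t r).len = r.len := len_ofFun _ _

theorem swapMap_swapMap (s t r : CompleteTree α L) : swapMap s t (swapMap s t r) = r := by
  classical
  refine ext_coord (by rw [len_swapMap, len_swapMap]) fun γ hγ => ?_
  rw [len_swapMap, len_swapMap] at hγ
  rw [swapMap, coord_ofFun _ _ (by rwa [len_swapMap]), swapMap, coord_ofFun _ _ hγ,
    Equiv.swap_apply_self]

theorem swapMap_mono (s t : CompleteTree α L) {r r' : CompleteTree α L} (h : r ≤ r') :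
    swapMap s t r ≤ swapMap s t r' := by
  rw [le_iff] at h ⊢
  refine ⟨by rw [len_swapMap, len_swapMap]; exact h.1, fun γ hγ => ?_⟩
  rw [len_swapMap] at hγ
  rw [swapMap, coord_ofFun _ _ hγ, swapMap, coord_ofFun _ _ (hγ.trans_le h.1), h.2 γ hγ]

theorem swapMap_left {s t : CompleteTree α L} (h : s.len = t.len) : swapMap s t s = t := by
  classical
  refine ext_coord (by rw [len_swapMap, h]) fun γ hγ => ?_
  rw [len_swapMap] at hγ
  rw [swapMap, coord_ofFun _ _ hγ, Equiv.swap_apply_left]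

theorem exists_orderIso_apply_eq (p q : Σ _ : M, CompleteTree α L) (h : p.2.len = q.2.len) :
    ∃ σ : (Σ _ : M, CompleteTree α L) ≃o (Σ _ : M, CompleteTree α L),
      σ p = q ∧ ∀ r, (σ r).2.len = r.2.len := by
  classical
  let f : (Σ _ : M, CompleteTree α L) → (Σ _ : M, CompleteTree α L) := fun r =>
    ⟨Equiv.swap p.1 q.1 r.1, swapMap p.2 q.2 r.2⟩
  have hinv : Function.Involutive f := fun r => by simp [f, swapMap_swapMap]
  have hmono : Monotone f := by
    rintro _ _ ⟨m, s, t, hst⟩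
    exact Sigma.LE.fiber _ _ _ (swapMap_mono _ _ hst)
  refine ⟨⟨hinv.toPerm f, fun {r r'} => ⟨fun hr => ?_, fun hr => hmono hr⟩⟩, ?_,
    fun r => len_swapMap _ _ _⟩
  · have := hmono hr
    simpa only [Function.Involutive.coe_toPerm, hinv _] using this
  · exact Sigma.ext (by simp [f]) (heq_of_eq (swapMap_left h))

theorem finite_node [Finite L] [Finite M] (p : Σ _ : M, CompleteTree α L) :
    (IsRank.node (fun p : (Σ _ : M, CompleteTree α L) => p.2.len) p).Finite := by
  refine Set.Finite.of_injOn (f := fun q => (q.1, q.2.coord (Ordinal.pred p.2.len)))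
    (t := Set.univ) (fun _ _ => Set.mem_univ _) ?_ Set.finite_univ
  rintro ⟨m, s⟩ ⟨hs, hs'⟩ ⟨m', s'⟩ ⟨hs₁, hs₁'⟩ heq
  obtain ⟨rfl, heq⟩ := Prod.mk_inj.1 heq
  dsimp only at hs hs₁ heq
  have key : ∀ {u : CompleteTree α L}, u.len = p.2.len →
      (∀ r < (⟨m, u⟩ : Σ _ : M, CompleteTree α L), r < p) →
      ∀ γ, γ + 1 < p.2.len → u.coord γ = p.2.coord γ := by
    intro u hu hu' γ hγ
    have hα : γ + 1 < α := hγ.trans p.2.len_lt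
    obtain ⟨n, t⟩ := p
    have hlt : (⟨m, ofFun (γ + 1) hα u.coord⟩ : Σ _ : M, CompleteTree α L) < ⟨m, u⟩ := by
      refine Sigma.LT.fiber _ _ _ (lt_iff.2 ⟨?_, fun δ hδ => ?_⟩)
      · rw [len_ofFun, hu]; exact hγ
      · rw [len_ofFun] at hδ
        exact coord_ofFun _ _ hδ
    obtain ⟨_, _, _, h⟩ := hu' _ hlt
    have := (lt_iff.1 h).2 γ (by rw [len_ofFun]; exact lt_add_one γ)
    rwa [coord_ofFun _ _ (lt_add_one γ)] at this
  rw [ext_coord (s := s) (t := s') (hs.trans hs₁.symm)]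
  intro γ hγ
  rw [hs] at hγ
  rcases (Order.add_one_le_of_lt hγ).eq_or_lt with h | h
  · rw [← h] at heq
    simpa using heq
  · rw [key hs hs' γ h, key hs₁ hs₁' γ h]

end CompleteTree

/-- Let `λ ≥ 2` and `μ ≥ 1` be cardinals (realized as types `L`, `M`)
and `α ≥ 1` an ordinal. The disjoint union of `μ`-many copies of the complete
`λ`-ary tree of height `α` is reversible iff `min{α, λ·μ} < ω`, i.e. iff `α` is
finite or `λ·μ` is finite. -/
theorem stmt17 {L M : Type u} (hL : 2 ≤ Cardinal.mk L) (hM : Nonempty M)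
    (α : Ordinal.{u}) (hα : 0 < α) :
    Reversible (Σ _ : M, CompleteTree α L) ↔
      α < Ordinal.omega0 ∨ Cardinal.mk L * Cardinal.mk M < Cardinal.aleph0 := by
  have : Nontrivial L := by
    rw [← Cardinal.one_lt_iff_nontrivial]
    exact lt_of_lt_of_le (by norm_num) hL
  constructor
  · intro hrev
    by_contra! h
    obtain ⟨hω, hcard⟩ := h
    refine SelfSimilar.infinite_imp_not_reversible (CompleteTree.selfSimilar (L := L) hω) ?_ hrev
    by_contra! hfin
    obtain ⟨hLfin, hMfin⟩ := hfin
    exact hcard.not_gt (Cardinal.mul_lt_aleph0 (Cardinal.lt_aleph0_of_finite L)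
      (Cardinal.lt_aleph0_of_finite M))
  · rintro (hω | hcard)
    · exact CompleteTree.isRank_len.reversible_of_finite_height hω (fun p => p.2.len_lt)
        CompleteTree.exists_succ
    · rcases Cardinal.mul_lt_aleph0_iff.1 hcard with h | h | ⟨hLfin, hMfin⟩
      · exact absurd h (Cardinal.mk_ne_zero L)
      · exact absurd h (Cardinal.mk_ne_zero M)
      · have : Finite L := Cardinal.lt_aleph0_iff_finite.1 hLfin
        have : Finite M := Cardinal.lt_aleph0_iff_finite.1 hMfin
        refine CompleteTree.isRank_len.reversible_of_finite_node CompleteTree.finite_node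
          fun p q hpq => ?_
        obtain ⟨σ, rfl, hσ⟩ := CompleteTree.exists_orderIso_apply_eq p q hpq
        exact IsRank.ncard_node_le_of_orderIso σ hσ p (CompleteTree.finite_node _)
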